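/- arXiv:1909.02347 — 3 statements merged into one kernel-verified Lean document; each statement's English description precedes it below -/
import Mathlib

section
/- Let G(θ) = (1 − exp(−κ/cos(θ−θ0)))·cos(θ−θ0) and F(θ) = G'(θ)·tan θ − G(θ). Then F(θ0) = e^{−κ}−1, F is strictly decreasing on [θ0, π/2) (indeed F'(θ) < 0 for θ ∈ [θ0, π/2) with θ > θ0, and F'(θ) ≤ 0 at θ0), and F(θ) → −∞ as θ → π/2 from the left. -/
open Real

/-- `G(θ) = (1 − e^{−κ/cos(θ−θ0)})·cos(θ−θ0)`. -/
noncomputable def G (θ0 κ θ : ℝ) : ℝ :=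
  (1 - Real.exp (-κ / Real.cos (θ - θ0))) * Real.cos (θ - θ0)

/-- `F(θ) = G'(θ)·tan θ − G(θ)`. -/
noncomputable def F (θ0 κ θ : ℝ) : ℝ :=
  deriv (G θ0 κ) θ * Real.tan θ - G θ0 κ θ

/-- The derivative of `G θ0 κ` at the points where `cos (θ - θ0)` does not vanish. -/
noncomputable def derivG (θ0 κ θ : ℝ) : ℝ :=
  -(1 - Real.exp (-κ / Real.cos (θ - θ0)) * (1 + κ / Real.cos (θ - θ0))) * Real.sin (θ - θ0)

lemma hasDerivAt_cos_sub (θ0 θ : ℝ) :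
    HasDerivAt (fun x => Real.cos (x - θ0)) (-Real.sin (θ - θ0)) θ := by
  simpa using ((hasDerivAt_id θ).sub_const θ0).cos

lemma hasDerivAt_exp_neg_div_cos_sub {θ0 θ : ℝ} (κ : ℝ) (h : Real.cos (θ - θ0) ≠ 0) :
    HasDerivAt (fun x => Real.exp (-κ / Real.cos (x - θ0)))
      (-Real.exp (-κ / Real.cos (θ - θ0)) * (κ * Real.sin (θ - θ0) / Real.cos (θ - θ0) ^ 2)) θ := by
  refine HasDerivAt.congr_deriv
    (((hasDerivAt_const θ (-κ)).div (hasDerivAt_cos_sub θ0 θ) h).exp) ?_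
  simp only [Pi.div_apply]
  field_simp
  ring

lemma hasDerivAt_G {θ0 θ : ℝ} (κ : ℝ) (h : Real.cos (θ - θ0) ≠ 0) :
    HasDerivAt (G θ0 κ) (derivG θ0 κ θ) θ := by
  refine HasDerivAt.congr_deriv
    (((hasDerivAt_exp_neg_div_cos_sub κ h).const_sub 1).mul (hasDerivAt_cos_sub θ0 θ)) ?_
  unfold derivG
  field_simp
  ring

lemma hasDerivAt_derivG {θ0 θ : ℝ} (κ : ℝ) (h : Real.cos (θ - θ0) ≠ 0) :
    HasDerivAt (derivG θ0 κ)
      (-Real.exp (-κ / Real.cos (θ - θ0)) * κ ^ 2 * Real.sin (θ - θ0) ^ 2 / Real.cos (θ - θ0) ^ 3 -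
        (1 - Real.exp (-κ / Real.cos (θ - θ0)) * (1 + κ / Real.cos (θ - θ0))) *
          Real.cos (θ - θ0)) θ := by
  have hsin : HasDerivAt (fun x => Real.sin (x - θ0)) (Real.cos (θ - θ0)) θ := by
    simpa using ((hasDerivAt_id θ).sub_const θ0).sin
  have hdiv := ((hasDerivAt_const θ κ).div (hasDerivAt_cos_sub θ0 θ) h).const_add 1
  refine HasDerivAt.congr_deriv
    ((((hasDerivAt_exp_neg_div_cos_sub κ h).mul hdiv).const_sub 1).neg.mul hsin) ?_
  simp only [Pi.div_apply, Pi.neg_apply, Pi.mul_apply]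
  field_simp
  ring

lemma eventually_cos_sub_ne_zero {θ0 θ : ℝ} (h : Real.cos (θ - θ0) ≠ 0) :
    ∀ᶠ x in nhds θ, Real.cos (x - θ0) ≠ 0 :=
  (hasDerivAt_cos_sub θ0 θ).continuousAt.eventually_ne h

lemma F_eq {θ0 θ : ℝ} (κ : ℝ) (h : Real.cos (θ - θ0) ≠ 0) :
    F θ0 κ θ = derivG θ0 κ θ * Real.tan θ - G θ0 κ θ := by
  rw [F, (hasDerivAt_G κ h).deriv]

lemma hasDerivAt_F {θ0 θ : ℝ} (κ : ℝ) (h : Real.cos (θ - θ0) ≠ 0) (hθ : Real.cos θ ≠ 0) :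
    HasDerivAt (F θ0 κ)
      (Real.tan θ * (-Real.exp (-κ / Real.cos (θ - θ0)) * κ ^ 2 * Real.sin (θ - θ0) ^ 2 /
          Real.cos (θ - θ0) ^ 3 -
        (1 - Real.exp (-κ / Real.cos (θ - θ0)) * (1 + κ / Real.cos (θ - θ0))) *
          Real.cos (θ - θ0) + derivG θ0 κ θ * Real.tan θ)) θ := by
  have hF : F θ0 κ =ᶠ[nhds θ] fun x => derivG θ0 κ x * Real.tan x - G θ0 κ x := by
    filter_upwards [eventually_cos_sub_ne_zero h] with x hx using F_eq κ hx
  refine HasDerivAt.congr_of_eventuallyEq ?_ hF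
  refine HasDerivAt.congr_deriv
    (((hasDerivAt_derivG κ h).mul (Real.hasDerivAt_tan hθ)).sub (hasDerivAt_G κ h)) ?_
  have htan : 1 / Real.cos θ ^ 2 = 1 + Real.tan θ ^ 2 := by
    rw [one_div, ← Real.inv_one_add_tan_sq hθ, inv_inv]
  rw [htan]
  ring

lemma exp_neg_mul_one_add_lt_one {u : ℝ} (hu : 0 < u) : Real.exp (-u) * (1 + u) < 1 := by
  rw [Real.exp_neg, inv_mul_lt_iff₀ (Real.exp_pos u)]
  linarith [Real.add_one_lt_exp hu.ne']

lemma one_sub_exp_mul_pos {κ c : ℝ} (hκ : 0 < κ) (hc : 0 < c) :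
    0 < 1 - Real.exp (-κ / c) * (1 + κ / c) := by
  rw [neg_div]
  linarith [exp_neg_mul_one_add_lt_one (div_pos hκ hc)]

lemma deriv_F_neg {θ0 κ θ : ℝ} (hθ0 : 0 < θ0) (hκ : 0 < κ) (hθ : θ ∈ Set.Ico θ0 (π / 2)) :
    deriv (F θ0 κ) θ < 0 := by
  obtain ⟨h1, h2⟩ := hθ
  have hc : 0 < Real.cos (θ - θ0) := Real.cos_pos_of_mem_Ioo ⟨by linarith, by linarith⟩
  have hcθ : 0 < Real.cos θ := Real.cos_pos_of_mem_Ioo ⟨by linarith, by linarith⟩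
  have hs : 0 ≤ Real.sin (θ - θ0) :=
    Real.sin_nonneg_of_nonneg_of_le_pi (by linarith) (by linarith)
  have ht : 0 < Real.tan θ := Real.tan_pos_of_pos_of_lt_pi_div_two (by linarith) h2
  have hg := one_sub_exp_mul_pos hκ hc
  rw [(hasDerivAt_F κ hc.ne' hcθ.ne').deriv]
  refine mul_neg_of_pos_of_neg ht ?_
  have h3 : 0 ≤ Real.exp (-κ / Real.cos (θ - θ0)) * κ ^ 2 * Real.sin (θ - θ0) ^ 2 /
      Real.cos (θ - θ0) ^ 3 := by positivity
  have h4 := mul_pos hg hc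
  have h5 := mul_nonneg (mul_nonneg hg.le hs) ht.le
  unfold derivG
  simp only [neg_mul, neg_div] at *
  linarith

lemma tendsto_F_atBot {θ0 κ : ℝ} (hθ0 : θ0 ∈ Set.Ioo 0 (π / 2)) (hκ : 0 < κ) :
    Filter.Tendsto (F θ0 κ) (nhdsWithin (π / 2) (Set.Iio (π / 2))) Filter.atBot := by
  obtain ⟨h1, h2⟩ := hθ0
  have hc : 0 < Real.cos (π / 2 - θ0) := Real.cos_pos_of_mem_Ioo ⟨by linarith, by linarith⟩
  have hs : 0 < Real.sin (π / 2 - θ0) := Real.sin_pos_of_pos_of_lt_pi (by linarith) (by linarith)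
  have hneg : derivG θ0 κ (π / 2) < 0 :=
    mul_neg_of_neg_of_pos (neg_neg_of_pos (one_sub_exp_mul_pos hκ hc)) hs
  have hdG : Filter.Tendsto (derivG θ0 κ) (nhdsWithin (π / 2) (Set.Iio (π / 2)))
      (nhds (derivG θ0 κ (π / 2))) :=
    (hasDerivAt_derivG κ hc.ne').continuousAt.tendsto.mono_left nhdsWithin_le_nhds
  have hG : Filter.Tendsto (G θ0 κ) (nhdsWithin (π / 2) (Set.Iio (π / 2)))
      (nhds (G θ0 κ (π / 2))) :=
    (hasDerivAt_G κ hc.ne').continuousAt.tendsto.mono_left nhdsWithin_le_nhds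
  have hlim := (hdG.neg_mul_atTop hneg Real.tendsto_tan_pi_div_two).atBot_add hG.neg
  refine hlim.congr' ?_
  filter_upwards [nhdsWithin_le_nhds (eventually_cos_sub_ne_zero hc.ne')] with x hx
  rw [F_eq κ hx, sub_eq_add_neg]

/-- `F(θ0) = e^{−κ} − 1`, `F` is strictly decreasing on `[θ0, π/2)`
(with `F' < 0` on `(θ0, π/2)` and `F'(θ0) ≤ 0`), and `F(θ) → −∞` as `θ → π/2⁻`. -/
theorem F_monotonicity (θ0 κ : ℝ) (hθ0 : θ0 ∈ Set.Ioo 0 (π / 2)) (hκ : 0 < κ) :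
    F θ0 κ θ0 = Real.exp (-κ) - 1 ∧
    StrictAntiOn (F θ0 κ) (Set.Ico θ0 (π / 2)) ∧
    (∀ θ ∈ Set.Ioo θ0 (π / 2), deriv (F θ0 κ) θ < 0) ∧
    deriv (F θ0 κ) θ0 ≤ 0 ∧
    Filter.Tendsto (F θ0 κ) (nhdsWithin (π / 2) (Set.Iio (π / 2))) Filter.atBot := by
  obtain ⟨h1, h2⟩ := hθ0
  refine ⟨?_, ?_, fun θ hθ => deriv_F_neg h1 hκ (Set.Ioo_subset_Ico_self hθ),
    (deriv_F_neg h1 hκ ⟨le_rfl, h2⟩).le, tendsto_F_atBot ⟨h1, h2⟩ hκ⟩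
  · rw [F_eq κ (by simp)]
    simp [derivG, G]
  · refine strictAntiOn_of_deriv_neg (convex_Ico θ0 (π / 2)) (fun θ hθ => ?_) fun θ hθ =>
      deriv_F_neg h1 hκ (interior_subset hθ)
    exact (differentiableAt_of_deriv_ne_zero
      (deriv_F_neg h1 hκ hθ).ne).continuousAt.continuousWithinAt
end

section
/- The function G(θ) = (1 − exp(−κ/cos(θ−θ0)))·cos(θ−θ0) satisfies: G(θ0) = 1−e^{−κ}, G'(θ0) = 0, and G'(θ) < 0 and G''(θ) < 0 for all θ ∈ (θ0, π/2). -/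
open Real

theorem one_sub_one_add_mul_exp_neg_pos {x : ℝ} (hx : 0 < x) :
    0 < 1 - (1 + x) * Real.exp (-x) := by
  have h : (1 + x) * Real.exp (-x) < Real.exp x * Real.exp (-x) :=
    mul_lt_mul_of_pos_right (by linarith [Real.add_one_lt_exp hx.ne']) (Real.exp_pos _)
  rw [← Real.exp_add, add_neg_cancel, Real.exp_zero] at h
  linarith

theorem hasDerivAt_cos_sub_const (a x : ℝ) :
    HasDerivAt (fun y => Real.cos (y - a)) (-Real.sin (x - a)) x := by
  simpa using ((hasDerivAt_id x).sub_const a).cos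

theorem hasDerivAt_div_cos_sub_const {a x : ℝ} (κ : ℝ) (hc : Real.cos (x - a) ≠ 0) :
    HasDerivAt (fun y => κ / Real.cos (y - a))
      (κ * Real.sin (x - a) / Real.cos (x - a) ^ 2) x := by
  refine ((hasDerivAt_const x κ).fun_div (hasDerivAt_cos_sub_const a x) hc).congr_deriv ?_
  ring

theorem hasDerivAt_G_s6 {θ0 θ : ℝ} (κ : ℝ) (hc : Real.cos (θ - θ0) ≠ 0) :
    HasDerivAt (G θ0 κ) (-Real.sin (θ - θ0) *
      (1 - (1 + κ / Real.cos (θ - θ0)) * Real.exp (-(κ / Real.cos (θ - θ0))))) θ := by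
  have h := ((hasDerivAt_div_cos_sub_const κ hc).fun_neg.exp.const_sub 1).fun_mul
    (hasDerivAt_cos_sub_const θ0 θ)
  have hG : G θ0 κ = fun y =>
      (1 - Real.exp (-(κ / Real.cos (y - θ0)))) * Real.cos (y - θ0) := by
    funext y
    rw [G, neg_div]
  rw [hG]
  refine h.congr_deriv ?_
  field_simp
  ring

theorem hasDerivAt_deriv_G {θ0 θ : ℝ} (κ : ℝ) (hc : Real.cos (θ - θ0) ≠ 0) :
    HasDerivAt (fun x => -Real.sin (x - θ0) *
        (1 - (1 + κ / Real.cos (x - θ0)) * Real.exp (-(κ / Real.cos (x - θ0)))))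
      (-(Real.cos (θ - θ0) *
          (1 - (1 + κ / Real.cos (θ - θ0)) * Real.exp (-(κ / Real.cos (θ - θ0))))) -
        Real.sin (θ - θ0) ^ 2 * ((κ / Real.cos (θ - θ0)) ^ 2 *
          Real.exp (-(κ / Real.cos (θ - θ0))) / Real.cos (θ - θ0))) θ := by
  have hd := hasDerivAt_div_cos_sub_const κ hc
  have hs := ((hasDerivAt_id' θ).sub_const θ0).sin.fun_neg
  refine (hs.fun_mul (((hd.const_add 1).fun_mul hd.fun_neg.exp).const_sub 1)).congr_deriv ?_
  field_simp
  ring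

/-- `G(θ0) = 1 − e^{−κ}`, `G'(θ0) = 0`, and `G' < 0`, `G'' < 0` on `(θ0, π/2)`. -/
theorem G_properties (θ0 κ : ℝ) (hθ0 : θ0 ∈ Set.Ioo 0 (π / 2)) (hκ : 0 < κ) :
    G θ0 κ θ0 = 1 - Real.exp (-κ) ∧
    deriv (G θ0 κ) θ0 = 0 ∧
    (∀ θ ∈ Set.Ioo θ0 (π / 2), deriv (G θ0 κ) θ < 0) ∧
    (∀ θ ∈ Set.Ioo θ0 (π / 2), deriv (deriv (G θ0 κ)) θ < 0) := by
  obtain ⟨h0, h1⟩ := hθ0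
  have hcos : ∀ θ ∈ Set.Ioo θ0 (π / 2), 0 < Real.cos (θ - θ0) := fun θ hθ =>
    Real.cos_pos_of_mem_Ioo ⟨by linarith [hθ.1, Real.pi_pos], by linarith [hθ.2]⟩
  have hsin : ∀ θ ∈ Set.Ioo θ0 (π / 2), 0 < Real.sin (θ - θ0) := fun θ hθ =>
    Real.sin_pos_of_pos_of_lt_pi (by linarith [hθ.1]) (by linarith [hθ.2, Real.pi_pos])
  refine ⟨by simp [G], ?_, fun θ hθ => ?_, fun θ hθ => ?_⟩
  · rw [(hasDerivAt_G_s6 κ (by simp : Real.cos (θ0 - θ0) ≠ 0)).deriv]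
    simp
  · rw [(hasDerivAt_G_s6 κ (hcos θ hθ).ne').deriv]
    exact mul_neg_of_neg_of_pos (neg_lt_zero.2 (hsin θ hθ))
      (one_sub_one_add_mul_exp_neg_pos (div_pos hκ (hcos θ hθ)))
  · have hc := hcos θ hθ
    have hev : deriv (G θ0 κ) =ᶠ[nhds θ] fun x => -Real.sin (x - θ0) *
        (1 - (1 + κ / Real.cos (x - θ0)) * Real.exp (-(κ / Real.cos (x - θ0)))) := by
      filter_upwards [Ioo_mem_nhds hθ.1 hθ.2] with x hx
      exact (hasDerivAt_G_s6 κ (hcos x hx).ne').deriv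
    rw [hev.deriv_eq, (hasDerivAt_deriv_G κ hc.ne').deriv]
    have hpos := one_sub_one_add_mul_exp_neg_pos (div_pos hκ hc)
    have : 0 < Real.cos (θ - θ0) *
        (1 - (1 + κ / Real.cos (θ - θ0)) * Real.exp (-(κ / Real.cos (θ - θ0)))) :=
      mul_pos hc hpos
    have : 0 ≤ Real.sin (θ - θ0) ^ 2 * ((κ / Real.cos (θ - θ0)) ^ 2 *
        Real.exp (-(κ / Real.cos (θ - θ0))) / Real.cos (θ - θ0)) := by
      positivity
    linarith
end

section
/- There exist an angle θ0∈(0,π/2), constants ℓ,κ>0, and a nondecreasing light intensity function I:[0,∞)→[0,1] for which problem (OP1) admits two distinct optimal solutions. In fact one may take θ0 = π/4, ℓ = 6/5, κ = 1, and I the step function equal to ε on [0,1] and equal to 1 on (1,∞), for a suitable ε ∈ (0,1): for this ε the constant control θ1 ≡ π/4 (with height h1 = ℓ·sin(π/4)) and a control θ2 taking the value φ((e^{−1}−1)/ε) on [0,1] and π/4 above height 1 (reaching a height h2 > 1) are both optimal and achieve the same payoff. -/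
open Real MeasureTheory

/-- `g(θ) = (1 − e^{−κ/cos(θ−θ0)})·cos(θ−θ0)/sin θ`. -/
noncomputable def g (θ0 κ θ : ℝ) : ℝ :=
  (1 - Real.exp (-κ / Real.cos (θ - θ0))) * Real.cos (θ - θ0) / Real.sin θ

/-- Admissibility for problem (OP1). -/
def Adm (θ0 ℓ : ℝ) (h : ℝ) (θ : ℝ → ℝ) : Prop :=
  0 < h ∧ Measurable θ ∧ (∀ y ∈ Set.Icc 0 h, θ y ∈ Set.Icc θ0 (π / 2)) ∧
    (∫ y in (0 : ℝ)..h, 1 / Real.sin (θ y)) = ℓ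

/-- Payoff of problem (OP1). -/
noncomputable def J (θ0 κ : ℝ) (I : ℝ → ℝ) (h : ℝ) (θ : ℝ → ℝ) : ℝ :=
  ∫ y in (0 : ℝ)..h, I y * g θ0 κ (θ y)

/-- Tangent-line inequality for the concave function `c ↦ (1 - e^{-1/c}) c` on `c > 0`. -/
theorem one_sub_exp_mul_le_tangent {a c : ℝ} (ha : 0 < a) (hc : 0 < c) :
    (1 - Real.exp (-1 / c)) * c ≤ (1 - Real.exp (-1 / a)) * a
      + (1 - (1 + 1 / a) * Real.exp (-1 / a)) * (c - a) := by
  have h1 : Real.exp (-1 / a) * (1 / a - 1 / c + 1) ≤ Real.exp (-1 / c) := by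
    have h2 := Real.add_one_le_exp (1 / a - 1 / c)
    calc Real.exp (-1 / a) * (1 / a - 1 / c + 1)
        ≤ Real.exp (-1 / a) * Real.exp (1 / a - 1 / c) := by gcongr
      _ = Real.exp (-1 / c) := by rw [← Real.exp_add]; congr 1; ring
  have h3 := mul_le_mul_of_nonneg_right h1 hc.le
  have h4 : Real.exp (-1 / a) * (1 / a - 1 / c + 1) * c
      = Real.exp (-1 / a) * (c / a - 1 + c) := by
    field_simp
  have h5 : (1 - Real.exp (-1 / a)) * a
      + (1 - (1 + 1 / a) * Real.exp (-1 / a)) * (c - a)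
      = c - Real.exp (-1 / a) * (c / a - 1 + c) := by
    field_simp; ring
  rw [h5, ← h4]; linarith

theorem one_sub_one_add_inv_mul_exp_pos {a : ℝ} (ha : 0 < a) :
    0 < 1 - (1 + 1 / a) * Real.exp (-1 / a) := by
  have h1 : 1 / a + 1 < Real.exp (1 / a) := Real.add_one_lt_exp (by positivity)
  have h2 : Real.exp (1 / a) * Real.exp (-1 / a) = 1 := by
    rw [← Real.exp_add, ← Real.exp_zero]; congr 1; ring
  have h3 := mul_lt_mul_of_pos_right h1 (Real.exp_pos (-1 / a))
  linarith

theorem cos_sub_pi_div_four_pos {θ : ℝ} (hθ : θ ∈ Set.Icc (π / 4) (π / 2)) :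
    0 < Real.cos (θ - π / 4) :=
  Real.cos_pos_of_mem_Ioo ⟨by linarith [hθ.1, Real.pi_pos], by linarith [hθ.2, Real.pi_pos]⟩

theorem sin_pos_of_mem_Icc_pi {θ : ℝ} (hθ : θ ∈ Set.Icc (π / 4) (π / 2)) :
    0 < Real.sin θ :=
  Real.sin_pos_of_pos_of_lt_pi (by linarith [hθ.1, Real.pi_pos]) (by linarith [hθ.2, Real.pi_pos])

theorem G_pi_div_four : G (π / 4) 1 (π / 4) = 1 - Real.exp (-1) := by
  simp [G]

theorem G_le {θ : ℝ} (hθ : θ ∈ Set.Icc (π / 4) (π / 2)) :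
    G (π / 4) 1 θ ≤ 1 - Real.exp (-1) := by
  have h1 := one_sub_exp_mul_le_tangent one_pos (cos_sub_pi_div_four_pos hθ)
  have h2 := one_sub_one_add_inv_mul_exp_pos one_pos
  have h3 := Real.cos_le_one (θ - π / 4)
  have h4 := mul_nonneg h2.le (sub_nonneg.2 h3)
  simp only [G, div_one] at *
  linarith

theorem G_lt {θ : ℝ} (hθ : θ ∈ Set.Icc (π / 4) (π / 2)) (hne : θ ≠ π / 4) :
    G (π / 4) 1 θ < 1 - Real.exp (-1) := by
  have h1 := one_sub_exp_mul_le_tangent one_pos (cos_sub_pi_div_four_pos hθ)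
  have h2 := one_sub_one_add_inv_mul_exp_pos one_pos
  have h3 : Real.cos (θ - π / 4) < 1 := by
    have hlt : π / 4 < θ := lt_of_le_of_ne hθ.1 (Ne.symm hne)
    rw [← Real.cos_zero]
    exact Real.cos_lt_cos_of_nonneg_of_le_pi_div_two le_rfl
      (by linarith [hθ.2, Real.pi_pos]) (by linarith)
  have h4 := mul_pos h2 (sub_pos.2 h3)
  simp only [G, div_one] at *
  linarith

theorem G_pos {θ : ℝ} (hθ : θ ∈ Set.Icc (π / 4) (π / 2)) : 0 < G (π / 4) 1 θ := by
  have hc := cos_sub_pi_div_four_pos hθ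
  refine mul_pos (sub_pos.2 ?_) hc
  rw [Real.exp_lt_one_iff]
  exact div_neg_of_neg_of_pos (by norm_num) hc

theorem deriv_G {θ : ℝ} (hθ : θ ∈ Set.Icc (π / 4) (π / 2)) :
    deriv (G (π / 4) 1) θ =
      -((1 - (1 + 1 / Real.cos (θ - π / 4)) * Real.exp (-1 / Real.cos (θ - π / 4)))
        * Real.sin (θ - π / 4)) := by
  have hc := cos_sub_pi_div_four_pos hθ
  have h1 : HasDerivAt (fun t : ℝ => Real.cos (t - π / 4)) (-Real.sin (θ - π / 4)) θ := by
    simpa using ((hasDerivAt_id θ).sub_const (π / 4)).cos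
  have h2 := ((((hasDerivAt_const θ (-1 : ℝ)).div h1 hc.ne').exp).const_sub 1).mul h1
  have h3 : HasDerivAt (G (π / 4) 1) _ θ := h2
  rw [h3.deriv]
  simp only [Pi.div_apply]
  field_simp
  ring

/-- A critical point of `θ ↦ (ε G(θ) - K) / sin θ` on `[π/4, π/2)` is a global maximum. -/
theorem le_of_critical {ε p θ : ℝ} (hε0 : 0 < ε) (hε1 : ε < 1)
    (hp : p ∈ Set.Ico (π / 4) (π / 2))
    (hcrit : deriv (G (π / 4) 1) p * Real.tan p - G (π / 4) 1 p = (Real.exp (-1) - 1) / ε)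
    (hθ : θ ∈ Set.Icc (π / 4) (π / 2)) :
    (ε * G (π / 4) 1 θ - (1 - Real.exp (-1))) / Real.sin θ ≤
      (ε * G (π / 4) 1 p - (1 - Real.exp (-1))) / Real.sin p := by
  have hp' : p ∈ Set.Icc (π / 4) (π / 2) := ⟨hp.1, hp.2.le⟩
  have hcp := cos_sub_pi_div_four_pos hp'
  have hsp := sin_pos_of_mem_Icc_pi hp'
  have hsθ := sin_pos_of_mem_Icc_pi hθ
  have hcosp : 0 < Real.cos p :=
    Real.cos_pos_of_mem_Ioo ⟨by linarith [hp.1, Real.pi_pos], hp.2⟩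
  have htan := one_sub_exp_mul_le_tangent hcp (cos_sub_pi_div_four_pos hθ)
  have hA := one_sub_one_add_inv_mul_exp_pos hcp
  have hGp := G_le hp'
  have hGp0 := G_pos hp'
  rw [deriv_G hp', Real.tan_eq_sin_div_cos] at hcrit
  change G (π / 4) 1 θ ≤ G (π / 4) 1 p + _ at htan
  set A := 1 - (1 + 1 / Real.cos (p - π / 4)) * Real.exp (-1 / Real.cos (p - π / 4))
  set q := G (π / 4) 1 p
  set K := 1 - Real.exp (-1) with hK
  have hM : (ε * q - K) * Real.cos p = -(ε * A * Real.sin (p - π / 4) * Real.sin p) := by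
    have : Real.exp (-1) - 1 = -K := by rw [hK]; ring
    rw [this] at hcrit
    generalize Real.sin (p - π / 4) = s at hcrit ⊢
    have hε := hε0.ne'
    field_simp at hcrit
    linarith
  have hneg : ε * q - K ≤ 0 := by nlinarith
  have hx : Real.cos (θ - π / 4) = Real.cos (p - π / 4) * Real.cos (θ - p)
      - Real.sin (p - π / 4) * Real.sin (θ - p) := by
    rw [← Real.cos_add]; congr 1; ring
  have hs : Real.sin θ = Real.sin p * Real.cos (θ - p) + Real.cos p * Real.sin (θ - p) := by
    rw [← Real.sin_add]; congr 1; ring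
  have hd : 0 ≤ 1 - Real.cos (θ - p) := sub_nonneg.2 (Real.cos_le_one _)
  rw [div_le_div_iff₀ hsθ hsp]
  have e1 : (ε * q - K) * Real.sin θ = Real.sin p *
      ((ε * q - K) * Real.cos (θ - p) - ε * A * Real.sin (p - π / 4) * Real.sin (θ - p)) := by
    rw [hs]; linear_combination Real.sin (θ - p) * hM
  rw [e1, mul_comm _ (Real.sin p)]
  refine mul_le_mul_of_nonneg_left ?_ hsp.le
  have h6 := mul_le_mul_of_nonneg_left htan hε0.le
  rw [hx] at h6
  have h7 : 0 ≤ ε * A * Real.cos (p - π / 4) * (1 - Real.cos (θ - p)) := by positivity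
  have h8 := mul_nonneg (neg_nonneg.2 hneg) hd
  linarith

theorem g_eq (θ : ℝ) : g (π / 4) 1 θ = G (π / 4) 1 θ * (1 / Real.sin θ) := by
  simp only [g, G]; ring

theorem measurable_g (θ0 κ : ℝ) : Measurable (g θ0 κ) := by
  unfold g; fun_prop

theorem one_div_sin_le {θ : ℝ} (hθ : θ ∈ Set.Icc (π / 4) (π / 2)) :
    1 / Real.sin θ ≤ 1 / Real.sin (π / 4) := by
  have h4 : π / 4 ∈ Set.Icc (π / 4) (π / 2) := ⟨le_rfl, by linarith [Real.pi_pos]⟩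
  refine one_div_le_one_div_of_le (sin_pos_of_mem_Icc_pi h4) ?_
  exact Real.sin_le_sin_of_le_of_le_pi_div_two (by linarith [Real.pi_pos]) hθ.2 hθ.1

/-- The value of `ε` for which the best payoffs of short and tall plants coincide. -/
theorem exists_balanced_intensity : ∃ ε ∈ Set.Ioo (0 : ℝ) 1,
    (∀ θ ∈ Set.Icc (π / 4) (π / 2),
      ε * g (π / 4) 1 θ ≤ (1 - Real.exp (-1)) * (1 / Real.sin θ)
        + (1 - Real.exp (-1)) * (6 / 5) * (ε - 1)) ∧
    ∃ θ ∈ Set.Icc (π / 4) (π / 2),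
      ε * g (π / 4) 1 θ = (1 - Real.exp (-1)) * (1 / Real.sin θ)
        + (1 - Real.exp (-1)) * (6 / 5) * (ε - 1) := by
  set K := 1 - Real.exp (-1) with hK
  have hKpos : 0 < K := by
    have : Real.exp (-1) < 1 := by rw [Real.exp_lt_one_iff]; norm_num
    linarith
  have hs4 : Real.sin (π / 4) < 5 / 6 := by
    rw [Real.sin_pi_div_four]
    nlinarith [Real.sq_sqrt (show (0 : ℝ) ≤ 2 by norm_num), Real.sqrt_nonneg 2]
  let T : Set ℝ := Set.Icc (π / 4) (π / 2) ∩ {θ | 5 / 6 ≤ Real.sin θ}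
  have hT : IsCompact T :=
    isCompact_Icc.inter_right (isClosed_le continuous_const Real.continuous_sin)
  have hTtop : π / 2 ∈ T := ⟨⟨by linarith [Real.pi_pos], le_rfl⟩, by
    simp only [Set.mem_ofPred_eq, Real.sin_pi_div_two]; norm_num⟩
  have hGlt : ∀ θ ∈ T, G (π / 4) 1 θ < K := fun θ hθ => G_lt hθ.1 (by
    rintro rfl; exact absurd hθ.2 (not_le.2 hs4))
  have hu : ∀ θ ∈ T, 1 / Real.sin θ ≤ 6 / 5 := fun θ hθ => by
    have h := one_div_le_one_div_of_le (show (0 : ℝ) < 5 / 6 by norm_num) hθ.2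
    norm_num at h ⊢; exact h
  have hden : ∀ θ ∈ T, K * (6 / 5 - 1 / Real.sin θ) < K * (6 / 5) - g (π / 4) 1 θ :=
    fun θ hθ => by
      rw [g_eq]
      have := mul_lt_mul_of_pos_right (hGlt θ hθ)
        (one_div_pos.2 (sin_pos_of_mem_Icc_pi hθ.1))
      linarith
  have hden0 : ∀ θ ∈ T, 0 < K * (6 / 5) - g (π / 4) 1 θ := fun θ hθ =>
    (mul_nonneg hKpos.le (sub_nonneg.2 (hu θ hθ))).trans_lt (hden θ hθ)
  let r : ℝ → ℝ := fun θ => K * (6 / 5 - 1 / Real.sin θ) / (K * (6 / 5) - g (π / 4) 1 θ)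
  have hr : ContinuousOn r T := by
    have hsin : ∀ θ ∈ T, Real.sin θ ≠ 0 := fun θ hθ => (sin_pos_of_mem_Icc_pi hθ.1).ne'
    have hcos : ∀ θ ∈ T, Real.cos (θ - π / 4) ≠ 0 :=
      fun θ hθ => (cos_sub_pi_div_four_pos hθ.1).ne'
    have hg : ContinuousOn (g (π / 4) 1) T := by
      have hce : ContinuousOn (fun θ : ℝ => Real.cos (θ - π / 4)) T := by fun_prop
      exact ((continuousOn_const.sub (continuousOn_const.div hce hcos).rexp).mul hce).div
        Real.continuous_sin.continuousOn hsin
    exact (continuousOn_const.mul (continuousOn_const.sub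
      (continuousOn_const.div Real.continuous_sin.continuousOn hsin))).div
      (continuousOn_const.sub hg) fun θ hθ => (hden0 θ hθ).ne'
  obtain ⟨t, ht, hmax⟩ := hT.exists_isMaxOn ⟨_, hTtop⟩ hr
  have hr0 : 0 < r t := by
    refine lt_of_lt_of_le ?_ (hmax hTtop)
    refine div_pos (mul_pos hKpos ?_) (hden0 _ hTtop)
    rw [Real.sin_pi_div_two]; norm_num
  have hr1 : r t < 1 := (div_lt_one (hden0 t ht)).2 (hden t ht)
  refine ⟨r t, ⟨hr0, hr1⟩, fun θ hθ => ?_, t, ht.1, ?_⟩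
  · by_cases h : 5 / 6 ≤ Real.sin θ
    · have h1 : r θ ≤ r t := hmax (show θ ∈ T from ⟨hθ, h⟩)
      have h2 := (div_le_iff₀ (hden0 θ ⟨hθ, h⟩)).1 h1
      linarith
    · have h1 : 6 / 5 ≤ 1 / Real.sin θ := by
        rw [le_div_iff₀ (sin_pos_of_mem_Icc_pi hθ)]; linarith
      have h2 : g (π / 4) 1 θ ≤ K * (1 / Real.sin θ) := by
        rw [g_eq]
        exact mul_le_mul_of_nonneg_right (G_le hθ)
          (one_div_pos.2 (sin_pos_of_mem_Icc_pi hθ)).le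
      nlinarith [mul_nonneg hKpos.le (sub_nonneg.2 h1)]
  · have h2 : r t * (K * (6 / 5) - g (π / 4) 1 t) = K * (6 / 5 - 1 / Real.sin t) :=
      div_mul_cancel₀ _ (hden0 t ht).ne'
    linarith

theorem intervalIntegral_ite_le_one {a b h : ℝ} (hh : 1 ≤ h) :
    (∫ y in (0 : ℝ)..h, if y ≤ 1 then a else b) = a + (h - 1) * b := by
  have e1 : Set.EqOn (fun y : ℝ => if y ≤ 1 then a else b) (fun _ => a) (Set.uIoc 0 1) := by
    intro y hy
    rw [Set.uIoc_of_le zero_le_one] at hy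
    simp [hy.2]
  have e2 : Set.EqOn (fun y : ℝ => if y ≤ 1 then a else b) (fun _ => b) (Set.uIoc 1 h) := by
    intro y hy
    rw [Set.uIoc_of_le hh] at hy
    simp [not_le.2 hy.1]
  rw [← intervalIntegral.integral_add_adjacent_intervals (b := 1)
      ((intervalIntegrable_congr e1).2 intervalIntegrable_const)
      ((intervalIntegrable_congr e2).2 intervalIntegrable_const),
    intervalIntegral.integral_congr_ae (Filter.Eventually.of_forall fun y hy => e1 hy),
    intervalIntegral.integral_congr_ae (Filter.Eventually.of_forall fun y hy => e2 hy)]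
  simp

/-- For a two-step intensity, a pointwise bound below height `1` gives a bound on the payoff. -/
theorem J_le_of_balanced {ε : ℝ} (hε : ε ∈ Set.Ioo (0 : ℝ) 1)
    (hbal : ∀ θ ∈ Set.Icc (π / 4) (π / 2),
      ε * g (π / 4) 1 θ ≤ (1 - Real.exp (-1)) * (1 / Real.sin θ)
        + (1 - Real.exp (-1)) * (6 / 5) * (ε - 1))
    {h : ℝ} {θ : ℝ → ℝ} (hθ : Adm (π / 4) (6 / 5) h θ) :
    J (π / 4) 1 (fun y => if y ≤ 1 then ε else 1) h θ ≤
      ε * ((1 - Real.exp (-1)) * (6 / 5)) := by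
  obtain ⟨hh, hmeas, hmem, hint⟩ := hθ
  set K := 1 - Real.exp (-1) with hK
  have hg0 : ∀ t ∈ Set.Icc (π / 4) (π / 2), 0 ≤ g (π / 4) 1 t := fun t ht => by
    rw [g_eq]
    exact mul_nonneg (G_pos ht).le (one_div_pos.2 (sin_pos_of_mem_Icc_pi ht)).le
  have hgK : ∀ t ∈ Set.Icc (π / 4) (π / 2), g (π / 4) 1 t ≤ K * (1 / Real.sin t) :=
    fun t ht => by
      rw [g_eq]
      exact mul_le_mul_of_nonneg_right (G_le ht)
        (one_div_pos.2 (sin_pos_of_mem_Icc_pi ht)).le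
  have hu : IntervalIntegrable (fun y => 1 / Real.sin (θ y)) volume 0 h := by
    refine (intervalIntegrable_const (c := 1 / Real.sin (π / 4))).mono_fun'
      ((Real.measurable_sin.comp hmeas).const_div 1).aestronglyMeasurable ?_
    refine (ae_restrict_iff' measurableSet_uIoc).2 (Filter.Eventually.of_forall fun y hy => ?_)
    rw [Set.uIoc_of_le hh.le] at hy
    have ht := hmem y ⟨hy.1.le, hy.2⟩
    dsimp only
    rw [Real.norm_of_nonneg (one_div_pos.2 (sin_pos_of_mem_Icc_pi ht)).le]
    exact one_div_sin_le ht
  have hI : Measurable (fun y : ℝ => if y ≤ 1 then ε else 1) :=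
    Measurable.ite measurableSet_Iic measurable_const measurable_const
  have hI0 : ∀ y : ℝ, 0 ≤ (if y ≤ 1 then ε else 1) := fun y => by
    split_ifs <;> linarith [hε.1]
  have hI1 : ∀ y : ℝ, (if y ≤ 1 then ε else 1) ≤ 1 := fun y => by
    split_ifs <;> linarith [hε.2]
  have hJ : IntervalIntegrable
      (fun y => (if y ≤ 1 then ε else 1) * g (π / 4) 1 (θ y)) volume 0 h := by
    refine (hu.const_mul K).mono_fun'
      (hI.mul ((measurable_g _ _).comp hmeas)).aestronglyMeasurable ?_
    refine (ae_restrict_iff' measurableSet_uIoc).2 (Filter.Eventually.of_forall fun y hy => ?_)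
    rw [Set.uIoc_of_le hh.le] at hy
    have ht := hmem y ⟨hy.1.le, hy.2⟩
    dsimp only
    rw [Real.norm_of_nonneg (mul_nonneg (hI0 y) (hg0 _ ht))]
    exact (mul_le_of_le_one_left (hg0 _ ht) (hI1 y)).trans (hgK _ ht)
  unfold J
  rcases le_or_gt h 1 with h1 | h1
  · calc (∫ y in (0 : ℝ)..h, (if y ≤ 1 then ε else 1) * g (π / 4) 1 (θ y))
        ≤ ∫ y in (0 : ℝ)..h, ε * (K * (1 / Real.sin (θ y))) := by
          refine intervalIntegral.integral_mono_on hh.le hJ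
            ((hu.const_mul K).const_mul ε) fun y hy => ?_
          simp only [hy.2.trans h1, if_true]
          exact mul_le_mul_of_nonneg_left (hgK _ (hmem y hy)) hε.1.le
      _ = ε * (K * (6 / 5)) := by
          rw [intervalIntegral.integral_const_mul, intervalIntegral.integral_const_mul, hint]
  · have hc : IntervalIntegrable
        (fun y : ℝ => if y ≤ 1 then K * (6 / 5) * (ε - 1) else 0) volume 0 h := by
      refine (intervalIntegrable_const (c := |K * (6 / 5) * (ε - 1)|)).mono_fun'
        (Measurable.ite measurableSet_Iic measurable_const
          measurable_const).aestronglyMeasurable (Filter.Eventually.of_forall fun y => ?_)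
      dsimp only
      split_ifs
      · exact le_rfl
      · rw [norm_zero]; exact abs_nonneg _
    calc (∫ y in (0 : ℝ)..h, (if y ≤ 1 then ε else 1) * g (π / 4) 1 (θ y))
        ≤ ∫ y in (0 : ℝ)..h, (K * (1 / Real.sin (θ y))
            + if y ≤ 1 then K * (6 / 5) * (ε - 1) else 0) := by
          refine intervalIntegral.integral_mono_on hh.le hJ
            ((hu.const_mul K).add hc) fun y hy => ?_
          split_ifs
          · exact hbal _ (hmem y hy)
          · simpa using hgK _ (hmem y hy)
      _ = ε * (K * (6 / 5)) := by
          rw [intervalIntegral.integral_add (hu.const_mul K) hc,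
            intervalIntegral.integral_const_mul, hint, intervalIntegral_ite_le_one h1.le]
          ring

/-- Non-uniqueness example: with `θ0 = π/4`, `ℓ = 6/5`, `κ = 1` and a suitable two-step
light intensity `I` (equal to `ε` on `[0,1]` and `1` above), problem (OP1) admits two
distinct optimal solutions with equal payoffs: the constant control `θ1 ≡ π/4` of height
`h1 = ℓ·sin(π/4) < 1`, and a control `θ2` equal to `φ((e^{−1}−1)/ε)` below height `1`
and to `π/4` above, of height `h2 > 1`. -/
theorem op1_nonuniqueness (φ : ℝ → ℝ)
    (hφ : ∀ z ≤ Real.exp (-1 : ℝ) - 1, φ z ∈ Set.Ico (π / 4) (π / 2) ∧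
      deriv (G (π / 4) 1) (φ z) * Real.tan (φ z) - G (π / 4) 1 (φ z) = z) :
    ∃ ε ∈ Set.Ioo (0 : ℝ) 1, ∃ h2 > (1 : ℝ),
      let I : ℝ → ℝ := fun y => if y ≤ 1 then ε else 1
      let θ1 : ℝ → ℝ := fun _ => π / 4
      let h1 : ℝ := (6 / 5) * Real.sin (π / 4)
      let θ2 : ℝ → ℝ := fun y => if y ≤ 1 then φ ((Real.exp (-1 : ℝ) - 1) / ε) else π / 4
      Adm (π / 4) (6 / 5) h1 θ1 ∧ Adm (π / 4) (6 / 5) h2 θ2 ∧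
      (∀ h θ, Adm (π / 4) (6 / 5) h θ → J (π / 4) 1 I h θ ≤ J (π / 4) 1 I h1 θ1) ∧
      (∀ h θ, Adm (π / 4) (6 / 5) h θ → J (π / 4) 1 I h θ ≤ J (π / 4) 1 I h2 θ2) ∧
      J (π / 4) 1 I h1 θ1 = J (π / 4) 1 I h2 θ2 ∧
      h1 ≠ h2 := by
  obtain ⟨ε, hε, hbal, t, ht, hteq⟩ := exists_balanced_intensity
  have hKpos : 0 < 1 - Real.exp (-1) := by
    have : Real.exp (-1) < 1 := by rw [Real.exp_lt_one_iff]; norm_num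
    linarith
  obtain ⟨hp, hcrit⟩ := hφ ((Real.exp (-1 : ℝ) - 1) / ε) (by
    rw [div_le_iff₀ hε.1]; nlinarith [hε.2])
  set p := φ ((Real.exp (-1 : ℝ) - 1) / ε)
  have hJle := fun (h : ℝ) (θ : ℝ → ℝ) (hθ : Adm (π / 4) (6 / 5) h θ) =>
    J_le_of_balanced hε hbal hθ
  have hmax := le_of_critical hε.1 hε.2 hp hcrit ht
  have hp' : p ∈ Set.Icc (π / 4) (π / 2) := ⟨hp.1, hp.2.le⟩
  have h4 : π / 4 ∈ Set.Icc (π / 4) (π / 2) := ⟨le_rfl, by linarith [Real.pi_pos]⟩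
  have hs4 := sin_pos_of_mem_Icc_pi h4
  have hs4' : Real.sin (π / 4) < 5 / 6 := by
    rw [Real.sin_pi_div_four]
    nlinarith [Real.sq_sqrt (show (0 : ℝ) ≤ 2 by norm_num), Real.sqrt_nonneg 2]
  have hg4 : g (π / 4) 1 (π / 4) = (1 - Real.exp (-1)) * (1 / Real.sin (π / 4)) := by
    rw [g_eq, G_pi_div_four]
  set K := 1 - Real.exp (-1) with hK
  have hdiv : ∀ θ, (ε * G (π / 4) 1 θ - K) / Real.sin θ
      = ε * g (π / 4) 1 θ - K * (1 / Real.sin θ) := fun θ => by rw [g_eq]; ring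
  have hpeq : ε * g (π / 4) 1 p = K * (1 / Real.sin p) + K * (6 / 5) * (ε - 1) := by
    rw [hdiv, hdiv] at hmax
    have := hbal p hp'
    linarith
  have hup : 1 / Real.sin p < 6 / 5 := by
    by_contra! hge
    have hne : p ≠ π / 4 := by
      intro hpe
      rw [hpe, hg4] at hpeq
      have h1 : 6 / 5 < 1 / Real.sin (π / 4) := by
        rw [lt_div_iff₀ hs4]; linarith
      nlinarith [mul_pos (mul_pos hKpos (sub_pos.2 hε.2)) (sub_pos.2 h1)]
    have h1 := mul_lt_mul_of_pos_right (G_lt hp' hne)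
      (one_div_pos.2 (sin_pos_of_mem_Icc_pi hp'))
    rw [← g_eq] at h1
    have h2 := mul_lt_mul_of_pos_left h1 hε.1
    nlinarith [mul_nonneg (mul_nonneg hKpos.le (sub_pos.2 hε.2).le) (sub_nonneg.2 hge)]
  have hh2 : 1 < 1 + (6 / 5 - 1 / Real.sin p) * Real.sin (π / 4) := by
    linarith [mul_pos (sub_pos.2 hup) hs4]
  refine ⟨ε, hε, 1 + (6 / 5 - 1 / Real.sin p) * Real.sin (π / 4), hh2, ?_⟩
  intro I θ1 h1 θ2
  have hh1 : h1 < 1 := by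
    change 6 / 5 * Real.sin (π / 4) < 1
    linarith
  have hh1pos : 0 < h1 := mul_pos (by norm_num) hs4
  have hA1 : Adm (π / 4) (6 / 5) h1 θ1 := by
    refine ⟨hh1pos, measurable_const, fun _ _ => h4, ?_⟩
    simp only [θ1, h1, intervalIntegral.integral_const, sub_zero, smul_eq_mul]
    field_simp
  have hA2 : Adm (π / 4) (6 / 5) (1 + (6 / 5 - 1 / Real.sin p) * Real.sin (π / 4)) θ2 := by
    refine ⟨by linarith, Measurable.ite measurableSet_Iic measurable_const measurable_const,
      fun y _ => ?_, ?_⟩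
    · simp only [θ2]
      split_ifs
      · exact hp'
      · exact h4
    · have e : ∀ y, 1 / Real.sin (θ2 y)
          = if y ≤ 1 then 1 / Real.sin p else 1 / Real.sin (π / 4) := fun y => by
        simp only [θ2]; split_ifs <;> rfl
      simp only [e]
      rw [intervalIntegral_ite_le_one hh2.le, add_sub_cancel_left, mul_assoc,
        mul_one_div_cancel hs4.ne']
      ring
  have hJ1 : J (π / 4) 1 I h1 θ1 = ε * (K * (6 / 5)) := by
    have e : Set.EqOn (fun y => I y * g (π / 4) 1 (θ1 y))
        (fun _ => ε * g (π / 4) 1 (π / 4)) (Set.uIcc 0 h1) := fun y hy => by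
      rw [Set.uIcc_of_le hh1pos.le] at hy
      simp [I, θ1, hy.2.trans hh1.le]
    rw [J, intervalIntegral.integral_congr e, hg4]
    simp only [h1, intervalIntegral.integral_const, sub_zero, smul_eq_mul]
    field_simp
  have hJ2 : J (π / 4) 1 I (1 + (6 / 5 - 1 / Real.sin p) * Real.sin (π / 4)) θ2
      = ε * (K * (6 / 5)) := by
    have e : ∀ y, I y * g (π / 4) 1 (θ2 y)
        = if y ≤ 1 then ε * g (π / 4) 1 p else g (π / 4) 1 (π / 4) := fun y => by
      simp only [I, θ2]
      split_ifs
      · rfl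
      · exact one_mul _
    simp only [J, e]
    rw [intervalIntegral_ite_le_one hh2.le, hpeq, hg4]
    field_simp
    ring
  refine ⟨hA1, hA2, fun h θ hθ => ?_, fun h θ hθ => ?_, hJ1.trans hJ2.symm,
    (hh1.trans hh2).ne⟩
  · rw [hJ1]; exact hJle h θ hθ
  · rw [hJ2]; exact hJle h θ hθ
end
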